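/- arXiv:0903.2400 — 2 statements merged into one kernel-verified Lean document; each statement's English description precedes it below -/
import Mathlib

section
/- Let (a_n)_{n≥0} be a sequence of integers with a_n ≥ 4 for all n, and let Θ be as defined. Suppose ε, ε' ∈ {−1,0,1}^ℕ satisfy ε_k = ε'_k for all k < n and ε_n ≠ ε'_n, for some integer n ≥ 0. Set δ = 1/(a_0 a_1 ⋯ a_{n+1}). Then (1/3)·δ ≤ |Θ(ε) − Θ(ε')| ≤ (8/3)·δ. -/
/-- `Theta a ε = ∑_{n≥0} ε_n / (a_0 a_1 ⋯ a_{n+1})`. -/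
noncomputable def Theta (a : ℕ → ℤ) (ε : ℕ → ℤ) : ℝ :=
  ∑' n : ℕ, (ε n : ℝ) / ∏ j ∈ Finset.range (n + 2), (a j : ℝ)

lemma prod_range_pos_of_four_le {a : ℕ → ℤ} (ha : ∀ n, 4 ≤ a n) (m : ℕ) :
    0 < ∏ j ∈ Finset.range m, (a j : ℝ) :=
  Finset.prod_pos fun j _ => by
    have := ha j
    exact_mod_cast (by omega : 0 < a j)

lemma prod_range_mul_four_pow_le {a : ℕ → ℤ} (ha : ∀ n, 4 ≤ a n) (m k : ℕ) :
    (∏ j ∈ Finset.range m, (a j : ℝ)) * 4 ^ k ≤ ∏ j ∈ Finset.range (m + k), (a j : ℝ) := by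
  induction k with
  | zero => simp
  | succ k ih =>
    rw [← add_assoc, Finset.prod_range_succ, pow_succ, ← mul_assoc]
    have h4 : (4 : ℝ) ≤ a (m + k) := by exact_mod_cast ha (m + k)
    exact mul_le_mul ih h4 (by norm_num) (prod_range_pos_of_four_le ha _).le

lemma abs_div_prod_range_le {a : ℕ → ℤ} (ha : ∀ n, 4 ≤ a n) (m k : ℕ) {x c : ℝ}
    (hx : |x| ≤ c) :
    |x / ∏ j ∈ Finset.range (m + k), (a j : ℝ)| ≤
      c * (1 / ∏ j ∈ Finset.range m, (a j : ℝ)) * (1 / 4) ^ k := by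
  have hP := prod_range_pos_of_four_le ha m
  rw [abs_div, abs_of_pos (prod_range_pos_of_four_le ha (m + k))]
  calc |x| / ∏ j ∈ Finset.range (m + k), (a j : ℝ)
      ≤ c / ((∏ j ∈ Finset.range m, (a j : ℝ)) * 4 ^ k) :=
        div_le_div₀ ((abs_nonneg x).trans hx) hx (by positivity)
          (prod_range_mul_four_pow_le ha m k)
    _ = _ := by rw [one_div_pow]; field_simp

lemma summable_div_prod_range {a : ℕ → ℤ} (ha : ∀ n, 4 ≤ a n) {x : ℕ → ℝ} {c : ℝ}
    (hx : ∀ k, |x k| ≤ c) :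
    Summable fun k => x k / ∏ j ∈ Finset.range (k + 2), (a j : ℝ) := by
  refine Summable.of_norm_bounded
    ((summable_geometric_of_lt_one (by norm_num) (by norm_num : (1 / 4 : ℝ) < 1)).mul_left
      (c * (1 / ∏ j ∈ Finset.range 2, (a j : ℝ)))) fun k => ?_
  rw [Real.norm_eq_abs, add_comm k 2]
  exact abs_div_prod_range_le ha 2 k (hx k)

lemma abs_tsum_tail_div_prod_range_le {a : ℕ → ℤ} (ha : ∀ n, 4 ≤ a n) {x : ℕ → ℝ} {c : ℝ}
    (hx : ∀ k, |x k| ≤ c) (n : ℕ) :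
    |∑' k, x (k + (n + 1)) / ∏ j ∈ Finset.range (k + (n + 1) + 2), (a j : ℝ)| ≤
      c / 3 * (1 / ∏ j ∈ Finset.range (n + 2), (a j : ℝ)) := by
  have hg := (hasSum_geometric_of_lt_one (by norm_num) (by norm_num : (1 / 4 : ℝ) < 1)).mul_left
    (c * (1 / ∏ j ∈ Finset.range (n + 2), (a j : ℝ)) * (1 / 4))
  rw [← Real.norm_eq_abs]
  refine (tsum_of_norm_bounded hg fun k => ?_).trans (le_of_eq (by ring))
  rw [Real.norm_eq_abs, show k + (n + 1) + 2 = n + 2 + (k + 1) by ring]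
  exact (abs_div_prod_range_le ha (n + 2) (k + 1) (hx _)).trans (le_of_eq (by ring))

lemma Theta_sub_Theta {a : ℕ → ℤ} (ha : ∀ n, 4 ≤ a n) {ε ε' : ℕ → ℤ}
    (hε : ∀ k, |(ε k : ℝ)| ≤ 1) (hε' : ∀ k, |(ε' k : ℝ)| ≤ 1) :
    Theta a ε - Theta a ε' =
      ∑' k, ((ε k : ℝ) - ε' k) / ∏ j ∈ Finset.range (k + 2), (a j : ℝ) := by
  simp only [Theta, sub_div]
  exact ((summable_div_prod_range ha hε).tsum_sub (summable_div_prod_range ha hε')).symm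

/-- If `ε, ε' ∈ {-1,0,1}^ℕ` agree below `n` and differ at `n`, then with
`δ = 1/(a_0 ⋯ a_{n+1})` one has `δ/3 ≤ |Θ(ε) − Θ(ε')| ≤ (8/3)·δ`. -/
theorem stmt3 (a : ℕ → ℤ) (ha : ∀ n, 4 ≤ a n)
    (ε ε' : ℕ → ℤ)
    (hε : ∀ k, ε k ∈ ({-1, 0, 1} : Set ℤ))
    (hε' : ∀ k, ε' k ∈ ({-1, 0, 1} : Set ℤ))
    (n : ℕ) (hagree : ∀ k < n, ε k = ε' k) (hne : ε n ≠ ε' n)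
    (δ : ℝ) (hδ : δ = 1 / ∏ j ∈ Finset.range (n + 2), (a j : ℝ)) :
    (1 / 3) * δ ≤ |Theta a ε - Theta a ε'| ∧
      |Theta a ε - Theta a ε'| ≤ (8 / 3) * δ := by
  have abs_le_one : ∀ x : ℤ, x ∈ ({-1, 0, 1} : Set ℤ) → |(x : ℝ)| ≤ 1 := by
    rintro x (rfl | rfl | rfl) <;> norm_num
  have h1 := fun k => abs_le_one _ (hε k)
  have h1' := fun k => abs_le_one _ (hε' k)
  have h2 : ∀ k, |(ε k : ℝ) - ε' k| ≤ 2 := fun k =>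
    (abs_sub _ _).trans (by linarith [h1 k, h1' k])
  have hδ0 : 0 < δ := hδ ▸ one_div_pos.mpr (prod_range_pos_of_four_le ha _)
  have htail := abs_tsum_tail_div_prod_range_le ha h2 n
  have hn : 1 ≤ |(ε n : ℝ) - ε' n| := by
    exact_mod_cast Int.one_le_abs (sub_ne_zero.mpr hne)
  have hhead : ∑ k ∈ Finset.range n,
      ((ε k : ℝ) - ε' k) / ∏ j ∈ Finset.range (k + 2), (a j : ℝ) = 0 :=
    Finset.sum_eq_zero fun k hk => by simp [hagree k (Finset.mem_range.mp hk)]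
  rw [Theta_sub_Theta ha h1 h1', ← (summable_div_prod_range ha h2).sum_add_tsum_nat_add (n + 1),
    Finset.sum_range_succ, hhead, zero_add, div_eq_mul_one_div ((ε n : ℝ) - ε' n), ← hδ]
  rw [← hδ] at htail
  set T := ∑' k, ((ε (k + (n + 1)) : ℝ) - ε' (k + (n + 1))) /
    ∏ j ∈ Finset.range (k + (n + 1) + 2), (a j : ℝ)
  have hmul : |((ε n : ℝ) - ε' n) * δ| = |(ε n : ℝ) - ε' n| * δ := by
    rw [abs_mul, abs_of_pos hδ0]
  have hlo := mul_le_mul_of_nonneg_right hn hδ0.le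
  have hhi := mul_le_mul_of_nonneg_right (h2 n) hδ0.le
  constructor
  · have := abs_sub_abs_le_abs_add (((ε n : ℝ) - ε' n) * δ) T
    linarith
  · have := abs_add_le (((ε n : ℝ) - ε' n) * δ) T
    linarith
end

section
/- Let (a_n)_{n≥0} be a sequence of integers with a_n ≥ 4 for all n. Then the map Θ : {−1,0,1}^ℕ → ℝ is continuous (where {−1,0,1}^ℕ carries the product topology) and injective; consequently Θ is a homeomorphism from {−1,0,1}^ℕ onto its image C_0. -/
/-- `Θ` viewed as a map on the space `{-1,0,1}^ℕ` with the product topology. -/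
noncomputable def ThetaMap (a : ℕ → ℤ) (ε : ℕ → ({-1, 0, 1} : Set ℤ)) : ℝ :=
  Theta a fun n => (ε n : ℤ)

theorem le_geometric_of_succ_le_div_four {w : ℕ → ℝ} (hw : ∀ n, w (n + 1) ≤ w n / 4)
    (N k : ℕ) : w (N + k) ≤ w N * (1 / 4) ^ k := by
  induction k with
  | zero => simp
  | succ k ih =>
    have h := hw (N + k)
    rw [← add_assoc, pow_succ]
    linarith

theorem tsum_mul_ne_zero_of_leading_coeff {w d : ℕ → ℝ} (hpos : ∀ n, 0 < w n)
    (hw : ∀ n, w (n + 1) ≤ w n / 4) (hd : ∀ n, |d n| ≤ 2) {N : ℕ}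
    (hzero : ∀ i < N, d i = 0) (hN : 1 ≤ |d N|) : ∑' n, d n * w n ≠ 0 := by
  have hbound (M k : ℕ) : ‖d (M + k) * w (M + k)‖ ≤ 2 * w M * (1 / 4) ^ k := by
    rw [Real.norm_eq_abs, abs_mul, abs_of_pos (hpos _), mul_assoc]
    exact mul_le_mul (hd _) (le_geometric_of_succ_le_div_four hw M k) (hpos _).le two_pos.le
  have hgeom (M : ℕ) : HasSum (fun k : ℕ => 2 * w M * (1 / 4 : ℝ) ^ k)
      (2 * w M * (1 - 1 / 4)⁻¹) :=
    (hasSum_geometric_of_lt_one (by norm_num) (by norm_num)).mul_left _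
  have hsum : Summable fun n => d n * w n :=
    .of_norm_bounded (hgeom 0).summable fun n => by simpa using hbound 0 n
  have htail : ‖∑' k, d (N + 1 + k) * w (N + 1 + k)‖ ≤ 2 * w (N + 1) * (1 - 1 / 4)⁻¹ :=
    tsum_of_norm_bounded (hgeom (N + 1)) (hbound (N + 1))
  have hinit : ∑ i ∈ Finset.range N, d i * w i = 0 :=
    Finset.sum_eq_zero fun i hi => by rw [hzero i (Finset.mem_range.1 hi), zero_mul]
  have hlead : w N ≤ |d N * w N| := by
    rw [abs_mul, abs_of_pos (hpos N)]
    exact le_mul_of_one_le_left (hpos N).le hN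
  intro h
  rw [← hsum.sum_add_tsum_nat_add (N + 1), Finset.sum_range_succ, hinit, zero_add] at h
  simp only [add_comm _ (N + 1)] at h
  rw [eq_neg_of_add_eq_zero_left h, abs_neg] at hlead
  rw [Real.norm_eq_abs] at htail
  have h1 := hw N
  have h2 := hpos N
  norm_num at htail
  linarith

theorem abs_cast_le_one (x : ({-1, 0, 1} : Set ℤ)) : |((x : ℤ) : ℝ)| ≤ 1 := by
  obtain ⟨x, rfl | rfl | rfl⟩ := x <;> simp

theorem summable_thetaMap_bound (a : ℕ → ℤ) :
    Summable fun n : ℕ => (∏ j ∈ Finset.range (0 + 2), (a j : ℝ))⁻¹ * (1 / 4 : ℝ) ^ n :=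
  (summable_geometric_of_lt_one (by norm_num) (by norm_num)).mul_left _

theorem inv_prod_range_pos {a : ℕ → ℤ} (ha : ∀ n, 4 ≤ a n) (n : ℕ) :
    0 < (∏ j ∈ Finset.range (n + 2), (a j : ℝ))⁻¹ :=
  inv_pos.2 <| Finset.prod_pos fun j _ => by
    have := ha j
    exact_mod_cast (by lia : 0 < a j)

theorem inv_prod_range_succ_le {a : ℕ → ℤ} (ha : ∀ n, 4 ≤ a n) (n : ℕ) :
    (∏ j ∈ Finset.range (n + 1 + 2), (a j : ℝ))⁻¹ ≤
      (∏ j ∈ Finset.range (n + 2), (a j : ℝ))⁻¹ / 4 := by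
  rw [show n + 1 + 2 = n + 2 + 1 by ring, Finset.prod_range_succ, mul_inv, div_eq_mul_inv]
  have h4 : (4 : ℝ) ≤ a (n + 2) := mod_cast ha (n + 2)
  exact mul_le_mul_of_nonneg_left (inv_anti₀ four_pos h4) (inv_prod_range_pos ha n).le

theorem norm_thetaMap_term_le {a : ℕ → ℤ} (ha : ∀ n, 4 ≤ a n)
    (n : ℕ) (ε : ℕ → ({-1, 0, 1} : Set ℤ)) :
    ‖((ε n : ℤ) : ℝ) / ∏ j ∈ Finset.range (n + 2), (a j : ℝ)‖ ≤
      (∏ j ∈ Finset.range (0 + 2), (a j : ℝ))⁻¹ * (1 / 4) ^ n := by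
  have h := le_geometric_of_succ_le_div_four
    (w := fun n => (∏ j ∈ Finset.range (n + 2), (a j : ℝ))⁻¹) (inv_prod_range_succ_le ha) 0 n
  simp only [zero_add n] at h
  rw [div_eq_mul_inv, Real.norm_eq_abs, abs_mul, abs_of_pos (inv_prod_range_pos ha n)]
  exact (mul_le_of_le_one_left (inv_prod_range_pos ha n).le (abs_cast_le_one _)).trans h

theorem continuous_thetaMap {a : ℕ → ℤ} (ha : ∀ n, 4 ≤ a n) : Continuous (ThetaMap a) := by
  refine continuous_tsum (fun n => ?_) (summable_thetaMap_bound a) (norm_thetaMap_term_le ha)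
  have hcast : Continuous fun x : ({-1, 0, 1} : Set ℤ) => ((x : ℤ) : ℝ) :=
    continuous_of_discreteTopology
  exact (hcast.comp (continuous_apply n)).div_const _

theorem injective_thetaMap {a : ℕ → ℤ} (ha : ∀ n, 4 ≤ a n) :
    Function.Injective (ThetaMap a) := by
  classical
  intro ε δ h
  by_contra hne
  have hex : ∃ n, ε n ≠ δ n := Function.ne_iff.1 hne
  have hs (ε : ℕ → ({-1, 0, 1} : Set ℤ)) :=
    Summable.of_norm_bounded (summable_thetaMap_bound a) (norm_thetaMap_term_le ha · ε)
  refine tsum_mul_ne_zero_of_leading_coeff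
    (w := fun n => (∏ j ∈ Finset.range (n + 2), (a j : ℝ))⁻¹)
    (d := fun n => ((ε n : ℤ) : ℝ) - ((δ n : ℤ) : ℝ))
    (N := Nat.find hex) (inv_prod_range_pos ha) (inv_prod_range_succ_le ha)
    (fun n => ?_) (fun i hi => ?_) ?_ ?_
  · have := abs_sub ((ε n : ℤ) : ℝ) ((δ n : ℤ) : ℝ)
    linarith [abs_cast_le_one (ε n), abs_cast_le_one (δ n)]
  · rw [not_not.1 (Nat.find_min hex hi), sub_self]
  · have hfind := Nat.find_spec hex
    exact_mod_cast Int.one_le_abs (sub_ne_zero.2 (Subtype.coe_injective.ne hfind))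
  · simp only [← div_eq_mul_inv, sub_div]
    rw [(hs ε).tsum_sub (hs δ)]
    exact sub_eq_zero.2 h

/-- If `a_n ≥ 4` for all `n`, then `Θ : {-1,0,1}^ℕ → ℝ` is continuous and
injective, and hence a homeomorphism (topological embedding) onto its image `C₀`. -/
theorem stmt4 (a : ℕ → ℤ) (ha : ∀ n, 4 ≤ a n) :
    Continuous (ThetaMap a) ∧ Function.Injective (ThetaMap a) ∧
      Topology.IsEmbedding (ThetaMap a) :=
  ⟨continuous_thetaMap ha, injective_thetaMap ha,
    ((continuous_thetaMap ha).isClosedEmbedding (injective_thetaMap ha)).isEmbedding⟩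
end
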